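/- arXiv:2604.11119 — 2 statements merged into one kernel-verified Lean document; each statement's English description precedes it below -/
import Mathlib

section
/- Let K ≥ 1 be an integer, let τ > 0 and η > 0 be reals, and let s, r ∈ ℝ^K. Define p ∈ Δ_K by p_i = exp(s_i/τ) / Σ_{j=1}^K exp(s_j/τ), and define the DDO-RM target q ∈ Δ_K by q_i = exp((s_i + η r_i)/τ) / Σ_{j=1}^K exp((s_j + η r_j)/τ). Then the expected reward does not decrease under the update: Σ_{i=1}^K q_i r_i ≥ Σ_{i=1}^K p_i r_i, with equality if and only if the reward vector r is constant (r_i = r_j for all i, j), in which case q = p. -/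
open Finset Real

/-- The weighted Chebyshev identity. -/
lemma sum_sum_mul_sub_mul_sub {ι : Type*} [Fintype ι] (a w r : ι → ℝ) :
    ∑ i, ∑ j, a i * a j * ((w i - w j) * (r i - r j)) =
      2 * ((∑ i, a i) * (∑ i, a i * w i * r i) - (∑ i, a i * w i) * (∑ i, a i * r i)) := by
  have h : ∀ i j, a i * a j * ((w i - w j) * (r i - r j)) =
      a i * w i * r i * a j - a i * w i * (a j * r j) - a i * r i * (a j * w j)
        + a i * (a j * w j * r j) := fun i j ↦ by ring
  simp only [h, sum_add_distrib, sum_sub_distrib, ← mul_sum, ← sum_mul]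
  ring

lemma exp_mul_sub_exp_mul_mul_sub_pos {c x y : ℝ} (hc : 0 < c) (hxy : x ≠ y) :
    0 < (exp (c * x) - exp (c * y)) * (x - y) := by
  rcases hxy.lt_or_gt with h | h
  · exact mul_pos_of_neg_of_neg
      (sub_neg.2 (exp_lt_exp.2 (mul_lt_mul_of_pos_left h hc))) (sub_neg.2 h)
  · exact mul_pos (sub_pos.2 (exp_lt_exp.2 (mul_lt_mul_of_pos_left h hc))) (sub_pos.2 h)

lemma exp_mul_sub_exp_mul_mul_sub_nonneg {c : ℝ} (hc : 0 < c) (x y : ℝ) :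
    0 ≤ (exp (c * x) - exp (c * y)) * (x - y) := by
  rcases eq_or_ne x y with rfl | h
  · simp
  · exact (exp_mul_sub_exp_mul_mul_sub_pos hc h).le

/-- The DDO-RM update does not decrease the expected reward:
`⟨q, r⟩ ≥ ⟨p, r⟩` for `p = softmax(s/τ)` and `q = softmax((s + η r)/τ)`,
with equality iff the reward vector is constant, in which case `q = p`. -/
theorem ddo_rm_expected_reward_improves
    (K : ℕ) (hK : 1 ≤ K) (τ η : ℝ) (hτ : 0 < τ) (hη : 0 < η)
    (s r : Fin K → ℝ)
    (p : Fin K → ℝ)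
    (hp : ∀ i, p i = Real.exp (s i / τ) / ∑ j, Real.exp (s j / τ))
    (q : Fin K → ℝ)
    (hq : ∀ i, q i = Real.exp ((s i + η * r i) / τ) /
      ∑ j, Real.exp ((s j + η * r j) / τ)) :
    (∑ i, p i * r i ≤ ∑ i, q i * r i) ∧
    ((∑ i, q i * r i = ∑ i, p i * r i) ↔ ∀ i j, r i = r j) ∧
    ((∀ i j, r i = r j) → q = p) := by
  have : Nonempty (Fin K) := ⟨⟨0, hK⟩⟩
  set a : Fin K → ℝ := fun i ↦ exp (s i / τ) with ha
  set w : Fin K → ℝ := fun i ↦ exp (η / τ * r i) with hw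
  have ha_pos : ∀ i, 0 < a i := fun i ↦ exp_pos _
  have hw_pos : ∀ i, 0 < w i := fun i ↦ exp_pos _
  have haw : ∀ i, exp ((s i + η * r i) / τ) = a i * w i := fun i ↦ by
    rw [ha, hw, ← exp_add]
    congr 1
    ring
  have hA : 0 < ∑ i, a i := sum_pos (fun i _ ↦ ha_pos i) univ_nonempty
  have hB : 0 < ∑ i, a i * w i :=
    sum_pos (fun i _ ↦ mul_pos (ha_pos i) (hw_pos i)) univ_nonempty
  have hp' : ∀ i, p i = a i / ∑ j, a j := hp
  have hq' : ∀ i, q i = a i * w i / ∑ j, a j * w j := fun i ↦ by simp only [hq, haw]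
  have hpr : ∑ i, p i * r i = (∑ i, a i * r i) / ∑ i, a i := by
    simp only [hp', sum_div, div_mul_eq_mul_div]
  have hqr : ∑ i, q i * r i = (∑ i, a i * w i * r i) / ∑ i, a i * w i := by
    simp only [hq', sum_div, div_mul_eq_mul_div]
  have hterm : ∀ i j, 0 ≤ a i * a j * ((w i - w j) * (r i - r j)) := fun i j ↦
    mul_nonneg (mul_pos (ha_pos i) (ha_pos j)).le
      (exp_mul_sub_exp_mul_mul_sub_nonneg (div_pos hη hτ) _ _)
  have hcheb := sum_sum_mul_sub_mul_sub a w r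
  have hconst : (∀ i j, r i = r j) → q = p := fun h ↦ by
    funext i
    have hwi : ∀ j, w j = w i := fun j ↦ by simp only [hw, h j i]
    rw [hq', hp']
    simp only [hwi, ← sum_mul]
    exact mul_div_mul_right _ _ (hw_pos i).ne'
  refine ⟨?_, ⟨fun h i j ↦ ?_, fun h ↦ by rw [hconst h]⟩, hconst⟩
  · rw [hpr, hqr, div_le_div_iff₀ hA hB]
    have := sum_nonneg fun i (_ : i ∈ univ) ↦ sum_nonneg fun j (_ : j ∈ univ) ↦ hterm i j
    linarith
  · rw [hpr, hqr, div_eq_div_iff hB.ne' hA.ne'] at h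
    by_contra hij
    have hpos : 0 < ∑ i, ∑ j, a i * a j * ((w i - w j) * (r i - r j)) :=
      sum_pos' (fun i _ ↦ sum_nonneg fun j _ ↦ hterm i j) ⟨i, mem_univ i,
        sum_pos' (fun j _ ↦ hterm i j) ⟨j, mem_univ j,
          mul_pos (mul_pos (ha_pos i) (ha_pos j))
            (exp_mul_sub_exp_mul_mul_sub_pos (div_pos hη hτ) hij)⟩⟩
    linarith
end

section
/- Let K ≥ 1 be an integer, let τ > 0 and η > 0 be reals, and let s, r ∈ ℝ^K. Define p ∈ Δ_K by p_i = exp(s_i/τ) / Σ_{j=1}^K exp(s_j/τ), and define q ∈ Δ_K by q_i = exp((s_i + η r_i)/τ) / Σ_{j=1}^K exp((s_j + η r_j)/τ). Then the Kullback–Leibler divergence of the updated distribution from the current policy is controlled by the reward gain: KL(q‖p) ≤ (η/τ)·(⟨q, r⟩ − ⟨p, r⟩). -/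
open Finset Real

/-- Kullback–Leibler divergence on ℝ^K. -/
noncomputable def KLdiv {K : ℕ} (u p : Fin K → ℝ) : ℝ :=
  ∑ i, u i * Real.log (u i / p i)

/-- Gibbs' inequality: the mean of a log-ratio under the denominator distribution is
nonpositive. -/
theorem sum_mul_log_div_nonpos {ι : Type*} [Fintype ι] {p q : ι → ℝ}
    (hp : ∀ i, 0 < p i) (hq : ∀ i, 0 < q i) (hpq : ∑ i, q i = ∑ i, p i) :
    ∑ i, p i * Real.log (q i / p i) ≤ 0 := by
  calc ∑ i, p i * Real.log (q i / p i)
      ≤ ∑ i, (q i - p i) := by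
        refine Finset.sum_le_sum fun i _ => ?_
        have h := mul_le_mul_of_nonneg_left
          (Real.log_le_sub_one_of_pos (div_pos (hq i) (hp i))) (hp i).le
        rwa [mul_sub, mul_div_cancel₀ _ (hp i).ne', mul_one] at h
    _ = 0 := by rw [Finset.sum_sub_distrib, hpq, sub_self]

/-- Conservativeness of the DDO-RM update: the KL divergence of the updated
distribution `q = softmax((s + η r)/τ)` from the current policy
`p = softmax(s/τ)` is controlled by the reward gain:
`KL(q‖p) ≤ (η/τ)·(⟨q, r⟩ − ⟨p, r⟩)`. -/
theorem ddo_rm_kl_controlled_by_reward_gain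
    (K : ℕ) (hK : 1 ≤ K) (τ η : ℝ) (hτ : 0 < τ) (hη : 0 < η)
    (s r : Fin K → ℝ)
    (p : Fin K → ℝ)
    (hp : ∀ i, p i = Real.exp (s i / τ) / ∑ j, Real.exp (s j / τ))
    (q : Fin K → ℝ)
    (hq : ∀ i, q i = Real.exp ((s i + η * r i) / τ) /
      ∑ j, Real.exp ((s j + η * r j) / τ)) :
    KLdiv q p ≤ (η / τ) * ((∑ i, q i * r i) - ∑ i, p i * r i) := by
  have : Nonempty (Fin K) := ⟨⟨0, hK⟩⟩
  set Z := ∑ j, Real.exp (s j / τ)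
  set W := ∑ j, Real.exp ((s j + η * r j) / τ)
  have hZ : 0 < Z := Finset.sum_pos (fun j _ => Real.exp_pos _) Finset.univ_nonempty
  have hW : 0 < W := Finset.sum_pos (fun j _ => Real.exp_pos _) Finset.univ_nonempty
  have hp_pos (i) : 0 < p i := hp i ▸ div_pos (Real.exp_pos _) hZ
  have hq_pos (i) : 0 < q i := hq i ▸ div_pos (Real.exp_pos _) hW
  have hp_sum : ∑ i, p i = 1 := by
    simp_rw [hp, ← Finset.sum_div]
    exact div_self hZ.ne'
  have hq_sum : ∑ i, q i = 1 := by
    simp_rw [hq, ← Finset.sum_div]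
    exact div_self hW.ne'
  have hlog (i) : Real.log (q i / p i) = η / τ * r i + (Real.log Z - Real.log W) := by
    rw [Real.log_div (hq_pos i).ne' (hp_pos i).ne', hp, hq,
      Real.log_div (Real.exp_ne_zero _) hW.ne', Real.log_div (Real.exp_ne_zero _) hZ.ne',
      Real.log_exp, Real.log_exp]
    ring
  have hmean (u : Fin K → ℝ) (hu : ∑ i, u i = 1) :
      ∑ i, u i * Real.log (q i / p i) =
        η / τ * ∑ i, u i * r i + (Real.log Z - Real.log W) := by
    simp_rw [hlog, mul_add, Finset.sum_add_distrib, ← Finset.sum_mul, hu, one_mul,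
      Finset.mul_sum, mul_left_comm]
  have gibbs := sum_mul_log_div_nonpos hp_pos hq_pos (hq_sum.trans hp_sum.symm)
  rw [hmean p hp_sum] at gibbs
  rw [KLdiv, hmean q hq_sum]
  linarith
end
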